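/- Let n ≥ 2 be an integer and α ∈ (0,1). Let V0, V1 : [0,1) → ℝ be real-valued functions such that V0, V1 ∈ C([0,1)) ∩ C^n((0,1)); x^α V0'(x) and y^α V1'(y) extend continuously to [0,1); and V0(0) = V1(0) = 0. Set m1 = lim_{x↓0} x^α V0'(x) and m2 = lim_{y↓0} y^α V1'(y). Then the C^n-solution V of the Goursat problem for the Euler–Darboux equation in D with data {V0, V1} satisfies, for each y ∈ [0,1): lim_{x↓0} x^α V_x(x,y) = m1/√(1−y), and for each x ∈ [0,1): lim_{y↓0} y^α V_y(x,y) = m2/√(1−x). -/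

import Mathlib

open Complex Set MeasureTheory Topology Filter ComplexConjugate

noncomputable section

/-- The triangle `D = {(x,y) : 0 ≤ x, 0 ≤ y, x + y < 1}`. -/
def TriD : Set (ℝ × ℝ) := {p | 0 ≤ p.1 ∧ 0 ≤ p.2 ∧ p.1 + p.2 < 1}

/-- Partial derivative in the first variable. -/
def pdx (f : ℝ → ℝ → ℂ) (x y : ℝ) : ℂ := deriv (fun t => f t y) x

/-- Partial derivative in the second variable. -/
def pdy (f : ℝ → ℝ → ℂ) (x y : ℝ) : ℂ := deriv (fun t => f x t) y

/-- Mixed second partial derivative. -/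
def pdxy (f : ℝ → ℝ → ℂ) (x y : ℝ) : ℂ := pdx (fun a b => pdy f a b) x y

/-- Partial derivative in the first variable (real valued). -/
def pdxR (f : ℝ → ℝ → ℝ) (x y : ℝ) : ℝ := deriv (fun t => f t y) x

/-- Partial derivative in the second variable (real valued). -/
def pdyR (f : ℝ → ℝ → ℝ) (x y : ℝ) : ℝ := deriv (fun t => f x t) y

/-- Mixed second partial derivative (real valued). -/
def pdxyR (f : ℝ → ℝ → ℝ) (x y : ℝ) : ℝ := pdxR (fun a b => pdyR f a b) x y

/-- The hyperbolic Ernst equation at a point. -/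
def ErnstEqAt (E : ℝ → ℝ → ℂ) (x y : ℝ) : Prop :=
  (((E x y).re : ℂ)) * (pdxy E x y - (pdx E x y + pdy E x y) / (2 * (1 - x - y))) =
    pdx E x y * pdy E x y

/-- The Euler–Darboux equation at a point. -/
def EulerDarbouxAt (V : ℝ → ℝ → ℝ) (x y : ℝ) : Prop :=
  pdxyR V x y - (pdxR V x y + pdyR V x y) / (2 * (1 - x - y)) = 0

/-- `λ(x,y,k) = √((k-(1-y))/(k-x))`, principal branch (`Re λ > 0` off the cut). -/
def lam (x y : ℝ) (k : ℂ) : ℂ := ((k - (1 - (y : ℂ))) / (k - (x : ℂ))) ^ (1/2 : ℂ)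

/-- The segment `[0,1]` inside `ℂ`. -/
def seg01 : Set ℂ := (fun t : ℝ => (t : ℂ)) '' Icc 0 1

/-- A `C^n`-solution of the Goursat problem for the hyperbolic Ernst equation in `D`
with data `{E0, E1}`, with regularity exponent `α`. -/
def ErnstSolutionWith (n : ℕ) (α : ℝ) (E : ℝ → ℝ → ℂ) (E0 E1 : ℝ → ℂ) : Prop :=
  ContinuousOn (fun p : ℝ × ℝ => E p.1 p.2) TriD ∧
  ContDiffOn ℝ n (fun p : ℝ × ℝ => E p.1 p.2) (interior TriD) ∧
  (∀ p ∈ interior TriD, ErnstEqAt E p.1 p.2) ∧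
  (∃ g : ℝ × ℝ → ℂ, ContinuousOn g TriD ∧
      ∀ p ∈ interior TriD, g p = ((p.1 ^ α : ℝ) : ℂ) * pdx E p.1 p.2) ∧
  (∃ g : ℝ × ℝ → ℂ, ContinuousOn g TriD ∧
      ∀ p ∈ interior TriD, g p = ((p.2 ^ α : ℝ) : ℂ) * pdy E p.1 p.2) ∧
  (∃ g : ℝ × ℝ → ℂ, ContinuousOn g TriD ∧
      ∀ p ∈ interior TriD, g p = ((p.1 ^ α * p.2 ^ α : ℝ) : ℂ) * pdxy E p.1 p.2) ∧
  (∀ x ∈ Ico (0:ℝ) 1, E x 0 = E0 x) ∧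
  (∀ y ∈ Ico (0:ℝ) 1, E 0 y = E1 y) ∧
  (∀ p ∈ TriD, 0 < (E p.1 p.2).re)

/-- A `C^n`-solution of the Goursat problem for the hyperbolic Ernst equation in `D`
(with regularity exponent `α` existentially quantified over `[0,1)`). -/
def ErnstSolution (n : ℕ) (E : ℝ → ℝ → ℂ) (E0 E1 : ℝ → ℂ) : Prop :=
  ∃ α ∈ Ico (0:ℝ) 1, ErnstSolutionWith n α E E0 E1

/-- A `C^n`-solution of the Goursat problem for the Euler–Darboux equation in `D`
with data `{V0, V1}`, with regularity exponent `α`. -/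
def EDSolutionWith (n : ℕ) (α : ℝ) (V : ℝ → ℝ → ℝ) (V0 V1 : ℝ → ℝ) : Prop :=
  ContinuousOn (fun p : ℝ × ℝ => V p.1 p.2) TriD ∧
  ContDiffOn ℝ n (fun p : ℝ × ℝ => V p.1 p.2) (interior TriD) ∧
  (∀ p ∈ interior TriD, EulerDarbouxAt V p.1 p.2) ∧
  (∃ g : ℝ × ℝ → ℝ, ContinuousOn g TriD ∧
      ∀ p ∈ interior TriD, g p = p.1 ^ α * pdxR V p.1 p.2) ∧
  (∃ g : ℝ × ℝ → ℝ, ContinuousOn g TriD ∧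
      ∀ p ∈ interior TriD, g p = p.2 ^ α * pdyR V p.1 p.2) ∧
  (∃ g : ℝ × ℝ → ℝ, ContinuousOn g TriD ∧
      ∀ p ∈ interior TriD, g p = p.1 ^ α * p.2 ^ α * pdxyR V p.1 p.2) ∧
  (∀ x ∈ Ico (0:ℝ) 1, V x 0 = V0 x) ∧
  (∀ y ∈ Ico (0:ℝ) 1, V 0 y = V1 y)

/-- A `C^n`-solution of the Goursat problem for the Euler–Darboux equation in `D`. -/
def EDSolution (n : ℕ) (V : ℝ → ℝ → ℝ) (V0 V1 : ℝ → ℝ) : Prop :=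
  ∃ α ∈ Ico (0:ℝ) 1, EDSolutionWith n α V V0 V1

/-- The data assumptions (1.5) on a single boundary datum for the Ernst equation. -/
def ErnstData (n : ℕ) (α : ℝ) (E0 : ℝ → ℂ) : Prop :=
  ContinuousOn E0 (Ico 0 1) ∧ ContDiffOn ℝ n E0 (Ioo 0 1) ∧
  (∃ g : ℝ → ℂ, ContinuousOn g (Ico 0 1) ∧
      ∀ x ∈ Ioo (0:ℝ) 1, g x = ((x ^ α : ℝ) : ℂ) * deriv E0 x) ∧
  E0 0 = 1 ∧ (∀ x ∈ Ico (0:ℝ) 1, 0 < (E0 x).re)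

/-- The data assumptions on a single boundary datum for the Euler–Darboux equation. -/
def EDData (n : ℕ) (α : ℝ) (V0 : ℝ → ℝ) : Prop :=
  ContinuousOn V0 (Ico 0 1) ∧ ContDiffOn ℝ n V0 (Ioo 0 1) ∧
  (∃ g : ℝ → ℝ, ContinuousOn g (Ico 0 1) ∧
      ∀ x ∈ Ioo (0:ℝ) 1, g x = x ^ α * deriv V0 x) ∧
  V0 0 = 0

/-- The matrix `U0(x,k)` of the x-part of the Lax pair, built from the boundary datum. -/
def U0mat (E0 : ℝ → ℂ) (x : ℝ) (k : ℂ) : Matrix (Fin 2) (Fin 2) ℂ :=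
  (1 / (2 * ((E0 x).re : ℂ))) •
    !![conj (deriv E0 x), lam x 0 k * conj (deriv E0 x);
       lam x 0 k * deriv E0 x, deriv E0 x]

/-- The matrix `U(x,y,k)` of the Lax pair. -/
def Umat (E : ℝ → ℝ → ℂ) (k : ℂ) (x y : ℝ) : Matrix (Fin 2) (Fin 2) ℂ :=
  (1 / (2 * ((E x y).re : ℂ))) •
    !![conj (pdx E x y), lam x y k * conj (pdx E x y);
       lam x y k * pdx E x y, pdx E x y]

/-- The matrix `V(x,y,k)` of the Lax pair. -/
def Vmat (E : ℝ → ℝ → ℂ) (k : ℂ) (x y : ℝ) : Matrix (Fin 2) (Fin 2) ℂ :=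
  (1 / (2 * ((E x y).re : ℂ))) •
    !![conj (pdy E x y), (lam x y k)⁻¹ * conj (pdy E x y);
       (lam x y k)⁻¹ * pdy E x y, pdy E x y]

/-- The interior of `TriD` is the open triangle. -/
lemma mem_interior_TriD {p : ℝ × ℝ} :
    p ∈ interior TriD ↔ 0 < p.1 ∧ 0 < p.2 ∧ p.1 + p.2 < 1 := by
  have h : TriD = (Ici 0 ×ˢ Ici 0) ∩ {p : ℝ × ℝ | p.1 + p.2 < 1} := by
    ext p
    simp only [TriD, mem_ofPred_eq, mem_inter_iff, mem_prod, mem_Ici, and_assoc]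
  have ho : IsOpen {p : ℝ × ℝ | p.1 + p.2 < 1} :=
    isOpen_lt (continuous_fst.add continuous_snd) continuous_const
  rw [h, interior_inter, interior_prod_eq, ho.interior_eq, interior_Ici, and_assoc.symm]
  rfl

/-- The derivative of `F` along the first coordinate direction. -/
lemma hasDerivAt_fst_of_differentiableAt {E : Type*} [NormedAddCommGroup E] [NormedSpace ℝ E]
    {F : ℝ × ℝ → E} {x y : ℝ} (hF : DifferentiableAt ℝ F (x, y)) :
    HasDerivAt (fun t => F (t, y)) (fderiv ℝ F (x, y) (1, 0)) x :=
  hF.hasFDerivAt.comp_hasDerivAt x ((hasDerivAt_id x).prodMk (hasDerivAt_const x y))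

/-- The derivative of `F` along the second coordinate direction. -/
lemma hasDerivAt_snd_of_differentiableAt {E : Type*} [NormedAddCommGroup E] [NormedSpace ℝ E]
    {F : ℝ × ℝ → E} {x y : ℝ} (hF : DifferentiableAt ℝ F (x, y)) :
    HasDerivAt (fun t => F (x, t)) (fderiv ℝ F (x, y) (0, 1)) y :=
  hF.hasFDerivAt.comp_hasDerivAt y ((hasDerivAt_const y x).prodMk (hasDerivAt_id y))

/-- Equality of mixed partial derivatives: `∂_y V_x = V_{xy}` for `V` of class `C^2`. -/
lemma hasDerivAt_pdxR_snd {V : ℝ → ℝ → ℝ} {x y : ℝ}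
    (hV : ContDiffAt ℝ 2 (fun p : ℝ × ℝ => V p.1 p.2) (x, y)) :
    HasDerivAt (fun s => pdxR V x s) (pdxyR V x y) y := by
  set F : ℝ × ℝ → ℝ := fun p => V p.1 p.2
  have hd : ∀ᶠ p in 𝓝 (x, y), DifferentiableAt ℝ F p := by
    filter_upwards [hV.eventually (by simp)] with p hp
    exact hp.differentiableAt (by simp)
  have hd2 : DifferentiableAt ℝ (fderiv ℝ F) (x, y) :=
    (hV.fderiv_right (m := 1) (by norm_num)).differentiableAt (by simp)
  have hx : ∀ᶠ t in 𝓝 x, pdyR V t y = fderiv ℝ F (t, y) (0, 1) := by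
    have hc : Tendsto (fun t : ℝ => (t, y)) (𝓝 x) (𝓝 (x, y)) :=
      (continuous_id.prodMk continuous_const).tendsto x
    filter_upwards [hc.eventually hd] with t ht
    exact (hasDerivAt_snd_of_differentiableAt ht).deriv
  have hy : ∀ᶠ t in 𝓝 y, pdxR V x t = fderiv ℝ F (x, t) (1, 0) := by
    have hc : Tendsto (fun t : ℝ => (x, t)) (𝓝 y) (𝓝 (x, y)) :=
      (continuous_const.prodMk continuous_id).tendsto y
    filter_upwards [hc.eventually hd] with t ht
    exact (hasDerivAt_fst_of_differentiableAt ht).deriv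
  have hxy : pdxyR V x y = fderiv ℝ (fderiv ℝ F) (x, y) (1, 0) (0, 1) := by
    have h := (hasDerivAt_fst_of_differentiableAt hd2).clm_apply
      (hasDerivAt_const x ((0, 1) : ℝ × ℝ))
    simp only [map_zero, add_zero] at h
    exact (h.congr_of_eventuallyEq hx).deriv
  have hsymm := hV.isSymmSndFDerivAt (by simp)
  have h := (hasDerivAt_snd_of_differentiableAt hd2).clm_apply
      (hasDerivAt_const y ((1, 0) : ℝ × ℝ))
  simp only [map_zero, add_zero] at h
  rw [hxy, hsymm.eq]
  exact h.congr_of_eventuallyEq hy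

/-- The Goursat problem is symmetric under exchanging the two variables. -/
lemma EDSolutionWith.swap {n : ℕ} (hn : 2 ≤ n) {β : ℝ} {V : ℝ → ℝ → ℝ} {V0 V1 : ℝ → ℝ}
    (hV : EDSolutionWith n β V V0 V1) :
    EDSolutionWith n β (fun x y => V y x) V1 V0 := by
  obtain ⟨hc, hd, heq, ⟨g1, hg1, hg1'⟩, ⟨g2, hg2, hg2'⟩, ⟨g3, hg3, hg3'⟩, h0, h1⟩ := hV
  have hD : MapsTo (Prod.swap : ℝ × ℝ → ℝ × ℝ) TriD TriD := fun p hp =>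
    ⟨hp.2.1, hp.1, by simpa [add_comm] using hp.2.2⟩
  have hI : MapsTo (Prod.swap : ℝ × ℝ → ℝ × ℝ) (interior TriD) (interior TriD) := by
    intro p hp
    rw [mem_interior_TriD] at hp ⊢
    exact ⟨hp.2.1, hp.1, by simpa [add_comm] using hp.2.2⟩
  have hxy : ∀ p ∈ interior TriD, pdxyR (fun x y => V y x) p.1 p.2 = pdxyR V p.2 p.1 := by
    intro p hp
    refine (hasDerivAt_pdxR_snd (V := V) (x := p.2) (y := p.1) ?_).deriv
    exact (hd.contDiffAt (isOpen_interior.mem_nhds (hI hp))).of_le (by exact_mod_cast hn)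
  refine ⟨hc.comp continuous_swap.continuousOn hD, hd.comp (contDiff_snd.prodMk contDiff_fst).contDiffOn hI, ?_,
    ⟨g2 ∘ Prod.swap, hg2.comp continuous_swap.continuousOn hD, fun p hp => hg2' _ (hI hp)⟩,
    ⟨g1 ∘ Prod.swap, hg1.comp continuous_swap.continuousOn hD, fun p hp => hg1' _ (hI hp)⟩,
    ⟨g3 ∘ Prod.swap, hg3.comp continuous_swap.continuousOn hD, fun p hp => ?_⟩, h1, h0⟩
  · intro p hp
    have h := heq _ (hI hp)
    simp only [EulerDarbouxAt, hxy p hp, Prod.fst_swap, Prod.snd_swap] at h ⊢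
    rw [← h, show pdxR (fun x y => V y x) p.1 p.2 = pdyR V p.2 p.1 from rfl,
      show pdyR (fun x y => V y x) p.1 p.2 = pdxR V p.2 p.1 from rfl]
    ring
  · rw [hxy p hp, Function.comp_apply, hg3' _ (hI hp)]
    simp only [Prod.fst_swap, Prod.snd_swap]
    ring

/-- The `x`-derivative of a solution converges to the derivative of the boundary datum on the
side `y = 0`. -/
lemma EDSolutionWith.tendsto_pdxR {n : ℕ} (hn : 2 ≤ n) {β : ℝ} {V : ℝ → ℝ → ℝ}
    {V0 V1 : ℝ → ℝ} (hV : EDSolutionWith n β V V0 V1) {x : ℝ} (hx : x ∈ Ioo (0 : ℝ) 1) :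
    Tendsto (fun y => pdxR V x y) (𝓝[>] 0) (𝓝 (deriv V0 x)) := by
  obtain ⟨hc, hd, -, ⟨g, hg, hg'⟩, -, -, h0, -⟩ := hV
  set G : ℝ × ℝ → ℝ := fun p => p.1 ^ (-β) * g p with hG
  have hGV : ∀ p ∈ interior TriD, pdxR V p.1 p.2 = G p := by
    intro p hp
    have hp1 := (mem_interior_TriD.1 hp).1
    rw [hG]
    simp only
    rw [hg' p hp, ← mul_assoc, ← Real.rpow_add hp1]
    simp
  have hxD : (x, (0 : ℝ)) ∈ TriD := ⟨hx.1.le, le_rfl, by simpa using hx.2⟩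
  have hGc : ContinuousWithinAt G TriD (x, 0) :=
    ((continuousAt_fst.rpow_const (Or.inl hx.1.ne')).continuousWithinAt).mul (hg _ hxD)
  have hmem : ∀ᶠ q : ℝ × ℝ in 𝓝[>] 0 ×ˢ 𝓝 x, (q.2, q.1) ∈ interior TriD := by
    have h1 : ∀ᶠ y : ℝ in 𝓝[>] 0, y ∈ Ioo 0 ((1 - x) / 2) :=
      Ioo_mem_nhdsGT (by linarith [hx.2])
    have h2 : ∀ᶠ t : ℝ in 𝓝 x, t ∈ Ioo 0 ((1 + x) / 2) :=
      Ioo_mem_nhds hx.1 (by linarith [hx.2])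
    filter_upwards [h1.prod_mk h2] with q hq
    exact mem_interior_TriD.2 ⟨hq.2.1, hq.1.1, by simp only; linarith [hq.2.2, hq.1.2]⟩
  have hlim : Tendsto (fun q : ℝ × ℝ => G (q.2, q.1)) (𝓝[>] 0 ×ˢ 𝓝 x) (𝓝 (G (x, 0))) := by
    refine hGc.tendsto.comp (tendsto_nhdsWithin_iff.2 ⟨?_, ?_⟩)
    · rw [nhds_prod_eq]
      exact tendsto_snd.prodMk (tendsto_fst.mono_right nhdsWithin_le_nhds)
    · exact hmem.mono fun q hq => interior_subset hq
  have hlim0 : Tendsto (fun t : ℝ => G (t, 0)) (𝓝 x) (𝓝 (G (x, 0))) := by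
    refine hGc.tendsto.comp (tendsto_nhdsWithin_iff.2 ⟨?_, ?_⟩)
    · exact (continuous_id.prodMk continuous_const).tendsto x
    · filter_upwards [Ioo_mem_nhds hx.1 hx.2] with t ht
      exact ⟨ht.1.le, le_rfl, by simpa using ht.2⟩
  have hunif : TendstoUniformlyOnFilter (fun y t => G (t, y)) (fun t => G (t, 0))
      (𝓝[>] 0) (𝓝 x) := by
    rw [Metric.tendstoUniformlyOnFilter_iff]
    intro ε hε
    have h := (hlim0.comp (tendsto_snd (f := 𝓝[>] (0 : ℝ)))).dist hlim
    rw [dist_self] at h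
    exact h.eventually (gt_mem_nhds hε)
  have hder : HasDerivAt (fun t => V t 0) (G (x, 0)) x := by
    refine hasDerivAt_of_tendstoUniformlyOnFilter (f := fun y t => V t y) hunif ?_ ?_
    · filter_upwards [hmem] with q hq
      have h := (hd.contDiffAt (isOpen_interior.mem_nhds hq)).differentiableAt
        (by exact_mod_cast (by omega : n ≠ 0))
      have h' := (hasDerivAt_fst_of_differentiableAt h).differentiableAt.hasDerivAt
      rw [← hGV _ hq]
      exact h'
    · filter_upwards [Ioo_mem_nhds hx.1 hx.2] with t ht
      have htD : (t, (0 : ℝ)) ∈ TriD := ⟨ht.1.le, le_rfl, by simpa using ht.2⟩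
      refine Tendsto.comp (f := fun y : ℝ => (t, y)) (hc _ htD).tendsto (tendsto_nhdsWithin_iff.2 ⟨?_, ?_⟩)
      · exact ((continuous_const.prodMk continuous_id).tendsto 0).mono_left nhdsWithin_le_nhds
      · filter_upwards [Ioo_mem_nhdsGT (sub_pos.2 ht.2)] with y hy
        exact ⟨ht.1.le, hy.1.le, by simp only; linarith [hy.2]⟩
  have hV0 : deriv V0 x = G (x, 0) := by
    refine (hder.congr_of_eventuallyEq ?_).deriv
    filter_upwards [Ioo_mem_nhds hx.1 hx.2] with t ht
    exact (h0 t ⟨ht.1.le, ht.2⟩).symm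
  rw [hV0]
  have hy : Tendsto (fun y : ℝ => (y, x)) (𝓝[>] 0) (𝓝[>] 0 ×ˢ 𝓝 x) :=
    tendsto_id.prodMk tendsto_const_nhds
  refine (hlim.comp hy).congr' ?_
  filter_upwards [hy.eventually hmem] with y hy
  exact (hGV _ hy).symm

/-- A function whose derivative is `O(t ^ (-β))` with `β < 1` has bounded oscillation near `0`. -/
lemma abs_sub_le_of_abs_deriv_le_rpow {W W' : ℝ → ℝ} {a b β M : ℝ} (hβ : β < 1) (ha : 0 < a)
    (hab : a ≤ b) (hW : ∀ t ∈ Icc a b, HasDerivAt W (W' t) t)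
    (hbound : ∀ t ∈ Icc a b, |W' t| ≤ M * t ^ (-β)) :
    |W b - W a| ≤ M / (1 - β) * b ^ (1 - β) - M / (1 - β) * a ^ (1 - β) := by
  have hβ' : 1 - β ≠ 0 := by linarith
  have key := image_norm_le_of_norm_deriv_right_le_deriv_boundary'
    (f := fun t => W t - W a) (f' := W') (a := a) (b := b)
    (B := fun t => M / (1 - β) * t ^ (1 - β) - M / (1 - β) * a ^ (1 - β))
    (B' := fun t => M * t ^ (-β))
    (fun t ht => ((hW t ht).continuousAt.sub continuousAt_const).continuousWithinAt)
    (fun t ht => ((hW t ⟨ht.1, ht.2.le⟩).sub_const _).hasDerivWithinAt) (by simp)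
    (fun t ht => ?_) (fun t ht => ?_)
    (fun t ht => by simpa using hbound t ⟨ht.1, ht.2.le⟩)
  · simpa using key (right_mem_Icc.2 hab)
  · exact (((Real.continuousAt_rpow_const t _ (Or.inl (ha.trans_le ht.1).ne')).const_mul
      _).sub continuousAt_const).continuousWithinAt
  · have h := ((Real.hasDerivAt_rpow_const (p := 1 - β)
      (Or.inl (ha.trans_le ht.1).ne')).const_mul (M / (1 - β))).sub_const
        (M / (1 - β) * a ^ (1 - β))
    refine (h.congr_deriv ?_).hasDerivWithinAt
    rw [show 1 - β - 1 = -β by ring]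
    field_simp

/-- `√(1 - x - y) V_x(x,y)` differs from its value on the side `y = 0` by a quantity which stays
bounded as `x ↓ 0`. -/
lemma EDSolutionWith.exists_abs_sqrt_mul_pdxR_sub_le {n : ℕ} (hn : 2 ≤ n) {β : ℝ} (hβ : β < 1)
    {V : ℝ → ℝ → ℝ} {V0 V1 : ℝ → ℝ} (hV : EDSolutionWith n β V V0 V1) {y : ℝ}
    (hy : y ∈ Ioo (0 : ℝ) 1) :
    ∃ C, ∀ᶠ x in 𝓝[>] (0 : ℝ),
      |√(1 - x - y) * pdxR V x y - √(1 - x) * deriv V0 x| ≤ C := by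
  obtain ⟨-, hd, heq, -, ⟨g, hg, hg'⟩, -, -, -⟩ := id hV
  have hsub : Icc 0 ((1 - y) / 2) ×ˢ Icc 0 y ⊆ TriD := fun p hp =>
    ⟨hp.1.1, hp.2.1, by linarith [hp.1.2, hp.2.2, hy.2]⟩
  have hcont : ContinuousOn (fun p : ℝ × ℝ => g p / (2 * √(1 - p.1 - p.2)))
      (Icc 0 ((1 - y) / 2) ×ˢ Icc 0 y) := by
    refine (hg.mono hsub).div (by fun_prop) fun p hp => ?_
    have : 0 < √(1 - p.1 - p.2) := Real.sqrt_pos.2 (by linarith [(hsub hp).2.2])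
    positivity
  obtain ⟨M, hM⟩ := (isCompact_Icc.prod isCompact_Icc).exists_bound_of_continuousOn hcont
  have hM0 : 0 ≤ M :=
    (norm_nonneg _).trans (hM (0, 0) ⟨⟨le_rfl, by linarith [hy.2]⟩, ⟨le_rfl, hy.1.le⟩⟩)
  refine ⟨M / (1 - β) * y ^ (1 - β), ?_⟩
  filter_upwards [Ioo_mem_nhdsGT (show (0 : ℝ) < (1 - y) / 2 by linarith [hy.2])] with x hx
  have hmem : ∀ t ∈ Ioc 0 y, (x, t) ∈ interior TriD := fun t ht =>
    mem_interior_TriD.2 ⟨hx.1, ht.1, by simp only; linarith [hx.2, ht.2, hy.2]⟩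
  have hW : ∀ t ∈ Ioc 0 y, HasDerivAt (fun t => √(1 - x - t) * pdxR V x t)
      (t ^ (-β) * (g (x, t) / (2 * √(1 - x - t)))) t := by
    intro t ht
    have hpos : 0 < 1 - x - t := by linarith [hx.2, ht.2, hy.2]
    have hs : 0 < √(1 - x - t) := Real.sqrt_pos.2 hpos
    have h1 := ((hasDerivAt_id t).const_sub (1 - x)).sqrt hpos.ne'
    have h2 := hasDerivAt_pdxR_snd (V := V) (x := x) (y := t)
      ((hd.contDiffAt (isOpen_interior.mem_nhds (hmem t ht))).of_le (by exact_mod_cast hn))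
    refine (h1.mul h2).congr_deriv ?_
    have hE : pdxyR V x t - (pdxR V x t + pdyR V x t) / (2 * (1 - x - t)) = 0 :=
      heq _ (hmem t ht)
    have hpdy : t ^ (-β) * g (x, t) = pdyR V x t := by
      rw [hg' _ (hmem t ht), ← mul_assoc, ← Real.rpow_add ht.1]
      simp
    rw [sub_eq_zero.1 hE, ← mul_div_assoc (t ^ (-β)), hpdy]
    simp only [id]
    have hsq : 1 - x - t = √(1 - x - t) ^ 2 := (Real.sq_sqrt hpos.le).symm
    generalize √(1 - x - t) = s at hs hsq ⊢
    rw [hsq]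
    field_simp
    ring
  have hle : ∀ᶠ a in 𝓝[>] (0 : ℝ),
      |√(1 - x - y) * pdxR V x y - √(1 - x - a) * pdxR V x a| ≤ M / (1 - β) * y ^ (1 - β) := by
    filter_upwards [Ioo_mem_nhdsGT hy.1] with a ha
    have h := abs_sub_le_of_abs_deriv_le_rpow (M := M) hβ ha.1 ha.2.le
      (fun t ht => hW t ⟨ha.1.trans_le ht.1, ht.2⟩) (fun t ht => ?_)
    · refine h.trans (sub_le_self _ ?_)
      have h1 : 0 < 1 - β := by linarith
      have h2 := ha.1
      positivity
    · have ht0 : 0 < t := ha.1.trans_le ht.1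
      rw [abs_mul, abs_of_pos (Real.rpow_pos_of_pos ht0 _), mul_comm]
      gcongr
      exact hM (x, t) ⟨⟨hx.1.le, hx.2.le⟩, ⟨ht0.le, ht.2⟩⟩
  have hlim : Tendsto (fun a => √(1 - x - a) * pdxR V x a) (𝓝[>] 0)
      (𝓝 (√(1 - x) * deriv V0 x)) := by
    refine Tendsto.mul ?_ (hV.tendsto_pdxR hn ⟨hx.1, by linarith [hx.2, hy.1]⟩)
    have h : Continuous fun a : ℝ => √(1 - x - a) := by fun_prop
    simpa using (h.tendsto 0).mono_left nhdsWithin_le_nhds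
  exact le_of_tendsto (tendsto_const_nhds.sub hlim).abs hle

/-- Behavior of `x ^ α V_x` at the side `x = 0`. -/
lemma EDSolutionWith.tendsto_rpow_mul_pdxR {n : ℕ} (hn : 2 ≤ n) {α β : ℝ} (hα : 0 < α)
    (hβ : β < 1) {V : ℝ → ℝ → ℝ} {V0 V1 : ℝ → ℝ} (hV : EDSolutionWith n β V V0 V1) {m : ℝ}
    (hm : Tendsto (fun x : ℝ => x ^ α * deriv V0 x) (𝓝[>] 0) (𝓝 m)) {y : ℝ}
    (hy : y ∈ Ico (0 : ℝ) 1) :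
    Tendsto (fun x : ℝ => x ^ α * pdxR V x y) (𝓝[>] 0) (𝓝 (m / √(1 - y))) := by
  rcases hy.1.eq_or_lt with rfl | hy0
  · simp only [sub_zero, Real.sqrt_one, div_one]
    refine hm.congr' ?_
    filter_upwards [Ioo_mem_nhdsGT one_pos] with x hx
    congr 1
    refine EventuallyEq.deriv_eq ?_
    filter_upwards [Ioo_mem_nhds hx.1 hx.2] with t ht
    exact (hV.2.2.2.2.2.2.1 t ⟨ht.1.le, ht.2⟩).symm
  obtain ⟨C, hC⟩ := hV.exists_abs_sqrt_mul_pdxR_sub_le hn hβ ⟨hy0, hy.2⟩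
  have hpow : Tendsto (fun x : ℝ => x ^ α) (𝓝[>] 0) (𝓝 0) := by
    have h := (Real.continuousAt_rpow_const 0 α (Or.inr hα.le)).tendsto
    rw [Real.zero_rpow hα.ne'] at h
    exact h.mono_left nhdsWithin_le_nhds
  have hrem : Tendsto (fun x : ℝ => x ^ α *
      (√(1 - x - y) * pdxR V x y - √(1 - x) * deriv V0 x)) (𝓝[>] 0) (𝓝 0) :=
    hpow.zero_mul_isBoundedUnder_le (isBoundedUnder_of_eventually_le hC)
  have hs0 : Tendsto (fun x : ℝ => √(1 - x)) (𝓝[>] 0) (𝓝 1) := by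
    have h : Continuous fun x : ℝ => √(1 - x) := by fun_prop
    simpa using (h.tendsto 0).mono_left nhdsWithin_le_nhds
  have hsy : Tendsto (fun x : ℝ => √(1 - x - y)) (𝓝[>] 0) (𝓝 √(1 - y)) := by
    have h : Continuous fun x : ℝ => √(1 - x - y) := by fun_prop
    simpa using (h.tendsto 0).mono_left nhdsWithin_le_nhds
  have hne : √(1 - y) ≠ 0 := (Real.sqrt_pos.2 (sub_pos.2 hy.2)).ne'
  have htot := (hrem.add (hs0.mul hm)).div hsy hne
  rw [zero_add, one_mul] at htot
  refine htot.congr' ?_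
  filter_upwards [Ioo_mem_nhdsGT (sub_pos.2 hy.2)] with x hx
  have hs : √(1 - x - y) ≠ 0 := (Real.sqrt_pos.2 (by linarith [hx.2])).ne'
  simp only [Pi.div_apply]
  field_simp
  ring

/-- Boundary behavior of the solution of the Goursat problem for the
Euler–Darboux equation. -/
theorem eulerDarboux_goursat_boundary_behavior
    (n : ℕ) (hn : 2 ≤ n) (α : ℝ) (hα : α ∈ Ioo (0:ℝ) 1)
    (V0 V1 : ℝ → ℝ) (hd0 : EDData n α V0) (hd1 : EDData n α V1)
    (m1 m2 : ℝ)
    (hm1 : Tendsto (fun x : ℝ => x ^ α * deriv V0 x) (𝓝[>] 0) (𝓝 m1))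
    (hm2 : Tendsto (fun y : ℝ => y ^ α * deriv V1 y) (𝓝[>] 0) (𝓝 m2))
    (V : ℝ → ℝ → ℝ) (hV : EDSolution n V V0 V1) :
    (∀ y ∈ Ico (0:ℝ) 1,
      Tendsto (fun x : ℝ => x ^ α * pdxR V x y) (𝓝[>] 0) (𝓝 (m1 / Real.sqrt (1 - y)))) ∧
    (∀ x ∈ Ico (0:ℝ) 1,
      Tendsto (fun y : ℝ => y ^ α * pdyR V x y) (𝓝[>] 0) (𝓝 (m2 / Real.sqrt (1 - x)))) := by
  obtain ⟨β, hβ, hV⟩ := hV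
  exact ⟨fun y hy => hV.tendsto_rpow_mul_pdxR hn hα.1 hβ.2 hm1 hy,
    fun x hx => (hV.swap hn).tendsto_rpow_mul_pdxR hn hα.1 hβ.2 hm2 hx⟩
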